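/- Let K ≥ 1, and for each k ∈ {1,…,K} let V^{(k)} ∈ ℝ^{C×D} have no zero entries and pairwise distinct entries in its d-th column, and let a^{(k)} ∈ ℝ^C. Let x' ∈ ℝ^D with x'_d ≠ 0, and define the averaged predictive distribution p̄_c(x) = (1/K) Σ_{k=1}^{K} softmax(V^{(k)} x + a^{(k)})_c. Then for every class c, the Euclidean norm of the gradient of p̄_c evaluated at the scaled point x_α tends to 0 as α → ∞. -/

import Mathlib

/-- The softmax function on `ℝ^C`. -/
noncomputable def softmax {C : ℕ} (z : Fin C → ℝ) : Fin C → ℝ :=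
  fun c => Real.exp (z c) / ∑ c', Real.exp (z c')

/-- The point `x'` scaled by `α` in coordinate `d` (all other coordinates unchanged). -/
def scaled {D : ℕ} (x' : Fin D → ℝ) (d : Fin D) (α : ℝ) : Fin D → ℝ :=
  Function.update x' d (α * x' d)

open Filter Topology in
theorem tendsto_exp_neg_abs_mul_add {m : ℝ} (hm : m ≠ 0) (b : ℝ) :
    Tendsto (fun α : ℝ => Real.exp (-|α * m + b|)) atTop (𝓝 0) := by
  refine Real.tendsto_exp_neg_atTop_nhds_zero.comp ?_
  rcases lt_or_gt_of_ne hm with h | h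
  · exact tendsto_abs_atBot_atTop.comp
      (tendsto_atBot_add_const_right _ _ (tendsto_id.atTop_mul_const_of_neg h))
  · exact tendsto_abs_atTop_atTop.comp
      (tendsto_atTop_add_const_right _ _ (tendsto_id.atTop_mul_const h))

theorem sum_exp_pos {C : ℕ} (z : Fin C → ℝ) (c : Fin C) : 0 < ∑ c', Real.exp (z c') :=
  Finset.sum_pos (fun _ _ => Real.exp_pos _) ⟨c, Finset.mem_univ c⟩

theorem softmax_nonneg {C : ℕ} (z : Fin C → ℝ) (c : Fin C) : 0 ≤ softmax z c :=
  div_nonneg (Real.exp_pos _).le (sum_exp_pos z c).le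

theorem softmax_le_exp_sub {C : ℕ} (z : Fin C → ℝ) (c c' : Fin C) :
    softmax z c ≤ Real.exp (z c - z c') := by
  rw [Real.exp_sub]
  exact div_le_div_of_nonneg_left (Real.exp_pos _).le (Real.exp_pos _)
    (Finset.single_le_sum (f := fun i => Real.exp (z i)) (fun _ _ => (Real.exp_pos _).le)
      (Finset.mem_univ c'))

theorem softmax_le_one {C : ℕ} (z : Fin C → ℝ) (c : Fin C) : softmax z c ≤ 1 := by
  simpa using softmax_le_exp_sub z c c

theorem softmax_mul_softmax_le {C : ℕ} (z : Fin C → ℝ) (c c' : Fin C) :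
    softmax z c * softmax z c' ≤ Real.exp (-|z c - z c'|) := by
  rcases le_total 0 (z c - z c') with h | h
  · rw [abs_of_nonneg h, neg_sub]
    exact (mul_le_of_le_one_left (softmax_nonneg z c') (softmax_le_one z c)).trans
      (softmax_le_exp_sub z c' c)
  · rw [abs_of_nonpos h, neg_neg]
    exact (mul_le_of_le_one_right (softmax_nonneg z c) (softmax_le_one z c')).trans
      (softmax_le_exp_sub z c c')

theorem HasFDerivAt.softmax {E : Type*} [NormedAddCommGroup E] [NormedSpace ℝ E] {C : ℕ}
    {f : E → Fin C → ℝ} {L : Fin C → E →L[ℝ] ℝ} {x : E}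
    (hf : ∀ c, HasFDerivAt (fun y => f y c) (L c) x) (c : Fin C) :
    HasFDerivAt (fun y => softmax (f y) c)
      (∑ c', (softmax (f x) c * softmax (f x) c') • (L c - L c')) x := by
  have hS := (sum_exp_pos (f x) c).ne'
  have hsum : HasFDerivAt (fun y => ∑ c', Real.exp (f y c'))
      (∑ c', Real.exp (f x c') • L c') x :=
    HasFDerivAt.fun_sum fun c' _ => (hf c').exp
  have hquot := HasFDerivAt.fun_mul (hf c).exp ((hasDerivAt_inv hS).comp_hasFDerivAt x hsum)
  simp only [Function.comp_apply, ← div_eq_mul_inv] at hquot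
  refine HasFDerivAt.congr_fderiv hquot ?_
  ext v
  simp only [_root_.softmax, add_apply, smul_apply, sub_apply,
    sum_apply, smul_eq_mul]
  have hrw : ∀ c', Real.exp (f x c) / (∑ i, Real.exp (f x i)) *
      (Real.exp (f x c') / ∑ i, Real.exp (f x i)) * (L c v - L c' v) =
      Real.exp (f x c) / (∑ i, Real.exp (f x i)) ^ 2 *
        (Real.exp (f x c') * L c v - Real.exp (f x c') * L c' v) := fun c' => by
    field_simp
  simp only [hrw, ← Finset.mul_sum, Finset.sum_sub_distrib, ← Finset.sum_mul]
  field_simp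
  ring

theorem norm_gradient_eq_norm_fderiv {E : Type*} [NormedAddCommGroup E] [InnerProductSpace ℝ E]
    [CompleteSpace E] (f : E → ℝ) (x : E) : ‖gradient f x‖ = ‖fderiv ℝ f x‖ :=
  LinearIsometryEquiv.norm_map _ _

theorem mulVec_scaled {C D : ℕ} (V : Matrix (Fin C) (Fin D) ℝ) (x : Fin D → ℝ) (d : Fin D)
    (α : ℝ) (c : Fin C) :
    V.mulVec (scaled x d α) c = α * (V c d * x d) + V.mulVec (scaled x d 0) c := by
  have h : scaled x d α = Pi.single d (α * x d) + scaled x d 0 := by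
    ext i
    by_cases hi : i = d
    · subst hi; simp [scaled]
    · simp [scaled, hi]
  rw [h, Matrix.mulVec_add]
  simp [Matrix.mulVec_single]
  ring

theorem stmt_5 (D C K : ℕ) (hC : 1 ≤ C) (hK : 1 ≤ K)
    (V : Fin K → Matrix (Fin C) (Fin D) ℝ) (a : Fin K → Fin C → ℝ) (d : Fin D)
    (hV : ∀ k c d', V k c d' ≠ 0)
    (hcol : ∀ k, Function.Injective fun c => V k c d)
    (x' : Fin D → ℝ) (hx' : x' d ≠ 0) :
    ∀ c : Fin C,
      Filter.Tendsto
        (fun α : ℝ =>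
          ‖gradient
              (fun x : EuclideanSpace ℝ (Fin D) =>
                (1 / (K : ℝ)) *
                  ∑ k : Fin K, softmax ((V k).mulVec (WithLp.equiv 2 (Fin D → ℝ) x) + a k) c)
              ((WithLp.equiv 2 (Fin D → ℝ)).symm (scaled x' d α))‖)
        Filter.atTop (nhds 0) := by
  intro c
  let L : Fin K → Fin C → EuclideanSpace ℝ (Fin D) →L[ℝ] ℝ := fun k i =>
    LinearMap.toContinuousLinearMap
      (LinearMap.proj i ∘ₗ (V k).mulVecLin ∘ₗ (WithLp.linearEquiv 2 ℝ (Fin D → ℝ)).toLinearMap)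
  let z : Fin K → EuclideanSpace ℝ (Fin D) → Fin C → ℝ := fun k x =>
    (V k).mulVec (WithLp.equiv 2 (Fin D → ℝ) x) + a k
  have hz : ∀ k x i, HasFDerivAt (fun y => z k y i) (L k i) x := fun k x i =>
    (L k i).hasFDerivAt.add_const (a k i)
  let p : ℝ → EuclideanSpace ℝ (Fin D) := fun α =>
    (WithLp.equiv 2 (Fin D → ℝ)).symm (scaled x' d α)
  have hgrad : ∀ x, HasFDerivAt
      (fun y => (1 / (K : ℝ)) * ∑ k, softmax (z k y) c)
      ((1 / (K : ℝ)) • ∑ k, ∑ i, (softmax (z k x) c * softmax (z k x) i) • (L k c - L k i)) x :=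
    fun x => (HasFDerivAt.fun_sum fun k _ => HasFDerivAt.softmax (hz k x) c).const_mul _
  have hterm : ∀ k i, Filter.Tendsto (fun α =>
      (softmax (z k (p α)) c * softmax (z k (p α)) i) • (L k c - L k i)) Filter.atTop (nhds 0) := by
    intro k i
    by_cases hi : i = c
    · simp [hi]
    have hm : (V k c d - V k i d) * x' d ≠ 0 :=
      mul_ne_zero (sub_ne_zero.mpr fun h => hi (hcol k h).symm) hx'
    have hlim := tendsto_exp_neg_abs_mul_add hm (z k (p 0) c - z k (p 0) i)
    rw [← zero_smul ℝ (L k c - L k i)]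
    refine Filter.Tendsto.smul_const (squeeze_zero
      (fun α => mul_nonneg (softmax_nonneg _ _) (softmax_nonneg _ _)) (fun α => ?_) hlim) _
    have hzp : ∀ j, z k (p α) j = α * (V k j d * x' d) + z k (p 0) j := fun j => by
      simp only [z, p, Equiv.apply_symm_apply, Pi.add_apply, mulVec_scaled (V k) x' d α j]
      ring
    have hsub : z k (p α) c - z k (p α) i =
        α * ((V k c d - V k i d) * x' d) + (z k (p 0) c - z k (p 0) i) := by
      rw [hzp c, hzp i]
      ring
    exact hsub ▸ softmax_mul_softmax_le (z k (p α)) c i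
  have hlim := ((tendsto_finsetSum Finset.univ fun k _ =>
    tendsto_finsetSum Finset.univ fun i _ => hterm k i).const_smul (1 / (K : ℝ))).norm
  simp only [Finset.sum_const_zero, smul_zero, norm_zero] at hlim
  refine hlim.congr fun α => ?_
  rw [norm_gradient_eq_norm_fderiv]
  exact congrArg norm (hgrad (p α)).fderiv.symm
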